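/- Let λ ∈ 𝔽_q* have multiplicative order m > 1 and let γ : k̄* → k̄* be the map γ(t) = λt. For every integer n ≥ 1, the number of (nm)-element subsets S ⊆ k̄* with σ(S) = S and γ(S) = S equals the number of n-element subsets T ⊆ k̄* with σ(T) = T, namely (q−1)·(q^n − (−1)^n)/(q+1). -/

import Mathlib

noncomputable section

open Polynomial

namespace Hyp

attribute [local instance] Classical.propDecidable Classical.decEq

variable (F : Type) [Field F] [Fintype F]

/-- The embedding of `F` into its algebraic closure. -/
def em : F →+* AlgebraicClosure F := algebraMap F (AlgebraicClosure F)

/-- The Frobenius `t ↦ t^q` acting on `P¹(k̄) = k̄ ∪ {∞}`, where `∞ = none`. -/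
def frobP1 : Option (AlgebraicClosure F) → Option (AlgebraicClosure F) :=
  Option.map fun x => x ^ Fintype.card F

variable {F}

/-- The Möbius action of a `2×2` matrix `(a b; c d)` over `F` on `P¹(k̄) = k̄ ∪ {∞}`:
`t ↦ (at+b)/(ct+d)`, with the usual conventions at `∞` and at poles. -/
def moebius (γ : Matrix (Fin 2) (Fin 2) F) :
    Option (AlgebraicClosure F) → Option (AlgebraicClosure F)
  | none =>
      if γ 1 0 = 0 then none else some (em F (γ 0 0) / em F (γ 1 0))
  | some x =>
      if em F (γ 1 0) * x + em F (γ 1 1) = 0 then none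
      else some ((em F (γ 0 0) * x + em F (γ 0 1)) / (em F (γ 1 0) * x + em F (γ 1 1)))

/-- The local multiplier `j(γ,t)`. -/
def locMult (γ : Matrix (Fin 2) (Fin 2) F) :
    Option (AlgebraicClosure F) → AlgebraicClosure F
  | none => if γ 1 0 = 0 then em F (γ 1 1) else em F (-γ.det / γ 1 0)
  | some x =>
      if em F (γ 1 0) * x + em F (γ 1 1) = 0 then em F (γ 1 0)
      else em F γ.det / (em F (γ 1 0) * x + em F (γ 1 1))

/-- The global multiplier `J(γ,S) = ∏_{t ∈ S} j(γ,t)`. -/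
def Jmult (γ : Matrix (Fin 2) (Fin 2) F) (S : Finset (Option (AlgebraicClosure F))) :
    AlgebraicClosure F :=
  ∏ t ∈ S, locMult γ t

/-- `S` is a rational `n`-set of `P¹`: it has `n` elements and is Frobenius-stable. -/
def IsRatSet (n : ℕ) (S : Finset (Option (AlgebraicClosure F))) : Prop :=
  S.card = n ∧ S.image (frobP1 F) = S

/-- `m` is the order of `γ` in `PGL₂(F)`: the least positive integer such that `γ^m`
is a scalar matrix. -/
def IsPGLOrder (γ : Matrix (Fin 2) (Fin 2) F) (m : ℕ) : Prop :=
  IsLeast {n : ℕ | 0 < n ∧ ∃ lam : F, γ ^ n = lam • (1 : Matrix (Fin 2) (Fin 2) F)} m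

/-- `J(γ,S)` is a square in `F*`. -/
def IsSquareJ (γ : Matrix (Fin 2) (Fin 2) F) (S : Finset (Option (AlgebraicClosure F))) : Prop :=
  ∃ v : F, v ≠ 0 ∧ Jmult γ S = em F (v * v)

/-- The monic polynomial `f_S(x) = ∏_{t ∈ S, t ≠ ∞} (x - t)` attached to a finite subset
of `P¹(k̄)`. -/
def fpoly (S : Finset (Option (AlgebraicClosure F))) : Polynomial (AlgebraicClosure F) :=
  ∏ t ∈ S, t.elim 1 fun a => X - C a

/-- `t` belongs to `P¹(F) = F ∪ {∞}` inside `P¹(k̄)`. -/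
def inP1k (t : Option (AlgebraicClosure F)) : Prop :=
  t = none ∨ ∃ x : F, t = some (em F x)

/-- `t` belongs to `P¹(𝔽_{q²})` inside `P¹(k̄)`. -/
def inP1k2 [Fintype F] (t : Option (AlgebraicClosure F)) : Prop :=
  t = none ∨ ∃ x : AlgebraicClosure F, x ^ Fintype.card F ^ 2 = x ∧ t = some x

section Stable

variable {α : Type*}

/-- The `φ`-stable multisets of cardinality `n` not containing `z`. -/
def stableMultisets (φ : α ≃ α) (z : α) (n : ℕ) : Set (Multiset α) :=
  {M | z ∉ M ∧ M.card = n ∧ M.map φ = M}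

/-- The `φ`-stable finite sets of cardinality `n` not containing `z`. -/
def stableFinsets (φ : α ≃ α) (z : α) (n : ℕ) : Set (Finset α) :=
  {S | z ∉ S ∧ S.card = n ∧ S.map φ.toEmbedding = S}

lemma val_mem_stableMultisets_iff {φ : α ≃ α} {z : α} {n : ℕ} {S : Finset α} :
    S.val ∈ stableMultisets φ z n ↔ S ∈ stableFinsets φ z n := by
  simp [stableMultisets, stableFinsets, ← Finset.val_inj]

lemma finite_stableFinsets {φ : α ≃ α} {z : α} {n : ℕ} (h : (stableMultisets φ z n).Finite) :
    (stableFinsets φ z n).Finite :=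
  .of_finite_image (f := Finset.val) (h.subset (by
    rintro _ ⟨S, hS, rfl⟩
    exact val_mem_stableMultisets_iff.2 hS)) Finset.val_injective.injOn

lemma stableMultisets_zero (φ : α ≃ α) (z : α) : stableMultisets φ z 0 = {0} := by
  ext M
  simp only [stableMultisets, Set.mem_ofPred_eq, Multiset.card_eq_zero, Set.mem_singleton_iff]
  refine ⟨fun h => h.2.1, ?_⟩
  rintro rfl
  simp

lemma stableFinsets_zero (φ : α ≃ α) (z : α) : stableFinsets φ z 0 = {∅} := by
  ext S
  simp only [stableFinsets, Set.mem_ofPred_eq, Finset.card_eq_zero, Set.mem_singleton_iff]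
  refine ⟨fun h => h.2.1, ?_⟩
  rintro rfl
  simp

lemma map_equiv_eq_self_iff [DecidableEq α] (φ : α ≃ α) (M : Multiset α) :
    M.map φ = M ↔ ∀ x, M.count (φ x) = M.count x := by
  constructor
  · intro h x
    conv_lhs => rw [← h]
    exact Multiset.count_map_eq_count' _ _ φ.injective x
  · intro h
    ext y
    obtain ⟨x, rfl⟩ := φ.surjective y
    rw [Multiset.count_map_eq_count' _ _ φ.injective x, h]

lemma count_two_nsmul_add_val [DecidableEq α] (A : Multiset α) (B : Finset α) (x : α) :
    (2 • A + B.val).count x = 2 * A.count x + if x ∈ B then 1 else 0 := by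
  simp [Multiset.count_eq_of_nodup B.nodup]

lemma exists_two_nsmul_add_val [DecidableEq α] (M : Multiset α) :
    ∃ (A : Multiset α) (B : Finset α), 2 • A + B.val = M ∧
      (∀ x, A.count x = M.count x / 2) ∧ ∀ x, x ∈ B ↔ Odd (M.count x) := by
  have hA : ∃ A : Multiset α, ∀ x, A.count x = M.count x / 2 := by
    refine ⟨Finsupp.toMultiset ((Multiset.toFinsupp M).mapRange (· / 2) rfl), fun x => ?_⟩
    simp
  obtain ⟨A, hA⟩ := hA
  have hB : ∀ x, x ∈ M.toFinset.filter (fun x => Odd (M.count x)) ↔ Odd (M.count x) := by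
    intro x
    simp only [Finset.mem_filter, Multiset.mem_toFinset, and_iff_right_iff_imp]
    intro h
    exact Multiset.count_pos.1 h.pos
  refine ⟨A, _, ?_, hA, hB⟩
  ext x
  rw [count_two_nsmul_add_val, hA]
  simp only [hB]
  split_ifs with h <;> grind

/-- The count obtained from the fact that every multiset is uniquely twice a multiset plus a finite set. -/
lemma ncard_stableMultisets (φ : α ≃ α) (z : α)
    (hfin : ∀ n, (stableMultisets φ z n).Finite) (n : ℕ) :
    (stableMultisets φ z n).ncard = ∑ k ∈ Finset.range (n / 2 + 1),
      (stableMultisets φ z k).ncard * (stableFinsets φ z (n - 2 * k)).ncard := by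
  classical
  have : ∀ n, Finite (stableMultisets φ z n) := hfin
  have : ∀ n, Finite (stableFinsets φ z n) := fun n => finite_stableFinsets (hfin n)
  let f : (Σ k : Fin (n / 2 + 1), stableMultisets φ z k × stableFinsets φ z (n - 2 * k)) →
      stableMultisets φ z n := fun p => ⟨2 • p.2.1.1 + p.2.2.1.val, by
    obtain ⟨hA0, hA1, hA2⟩ := p.2.1.2
    obtain ⟨hB0, hB1, hB2⟩ := val_mem_stableMultisets_iff.2 p.2.2.2
    refine ⟨by simp_all [Multiset.mem_nsmul], ?_, ?_⟩
    · rw [Multiset.card_add, Multiset.card_nsmul, hA1, hB1]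
      have := p.1.2
      omega
    · rw [Multiset.map_add, Multiset.map_nsmul, hA2, hB2]⟩
  have hf : Function.Bijective f := by
    constructor
    · rintro ⟨k, ⟨A, hA⟩, ⟨B, hB⟩⟩ ⟨k', ⟨A', hA'⟩, ⟨B', hB'⟩⟩ h
      have h1 : ∀ x, (2 * A.count x + if x ∈ B then 1 else 0) =
          2 * A'.count x + if x ∈ B' then 1 else 0 := by
        intro x
        rw [← count_two_nsmul_add_val, ← count_two_nsmul_add_val]
        exact congrArg (Multiset.count x) (congrArg Subtype.val h)
      obtain rfl : A = A' := by
        ext x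
        have := h1 x
        split_ifs at this <;> omega
      obtain rfl : B = B' := by
        ext x
        have := h1 x
        split_ifs at this <;> simp_all
      obtain rfl : k = k' := Fin.ext (hA.2.1.symm.trans hA'.2.1)
      rfl
    · rintro ⟨M, hM0, hM1, hM2⟩
      obtain ⟨A, B, hAB, hA, hB⟩ := exists_two_nsmul_add_val M
      rw [map_equiv_eq_self_iff] at hM2
      have hcard : 2 * A.card + B.card = n := by
        rw [← hM1, ← hAB, Multiset.card_add, Multiset.card_nsmul, Finset.card_val]
      have hMz : M.count z = 0 := Multiset.count_eq_zero.2 hM0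
      refine ⟨⟨⟨A.card, by omega⟩, ⟨A, ?_, rfl, ?_⟩, ⟨B, ?_, ?_, ?_⟩⟩, Subtype.ext hAB⟩
      · rw [← Multiset.count_eq_zero, hA, hMz]
      · rw [map_equiv_eq_self_iff]
        intro x
        rw [hA, hA, hM2]
      · rw [hB, hMz]
        decide
      · dsimp only
        omega
      · ext y
        obtain ⟨x, rfl⟩ := φ.surjective y
        simp [hB, hM2]
  have h := Nat.card_congr (Equiv.ofBijective f hf)
  rw [Nat.card_sigma] at h
  simp only [Nat.card_prod, Nat.card_coe_set_eq] at h
  rw [← h, Finset.sum_range]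

/-- If the stable multisets are counted by `(q - 1) q ^ n`, the stable finite sets are counted
by `(q - 1) (q ^ n - (-1) ^ n) / (q + 1)`. -/
lemma ncard_stableFinsets (φ : α ≃ α) (z : α) (q : ℤ)
    (hfin : ∀ n, (stableMultisets φ z n).Finite)
    (hcard : ∀ n, ((stableMultisets φ z (n + 1)).ncard : ℤ) = (q - 1) * q ^ n) (n : ℕ) :
    (q + 1) * ((stableFinsets φ z (n + 1)).ncard : ℤ) =
      (q - 1) * (q ^ (n + 1) - (-1) ^ (n + 1)) := by
  have h0 : (stableMultisets φ z 0).ncard = 1 := by simp [stableMultisets_zero]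
  have hrec : ∀ n, ((stableMultisets φ z (n + 2)).ncard : ℤ) =
      (stableFinsets φ z (n + 2)).ncard + q * (stableMultisets φ z n).ncard
        - (stableFinsets φ z n).ncard := by
    intro n
    have hs : ∀ k, n + 2 - 2 * (k + 1) = n - 2 * k := by omega
    rw [ncard_stableMultisets φ z hfin (n + 2), ncard_stableMultisets φ z hfin n,
      show (n + 2) / 2 + 1 = (n / 2 + 1) + 1 by omega, Finset.sum_range_succ' _ (n / 2 + 1)]
    push_cast
    simp only [hs, hcard, Finset.sum_range_succ' _ (n / 2), h0, mul_zero, tsub_zero,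
      pow_zero, mul_one, Nat.cast_one, one_mul]
    rw [mul_add, Finset.mul_sum, Finset.sum_congr rfl fun k _ => show (q - 1) * q ^ (k + 1) *
      ((stableFinsets φ z (n - 2 * (k + 1))).ncard : ℤ) = q * ((q - 1) * q ^ k *
        ((stableFinsets φ z (n - 2 * (k + 1))).ncard : ℤ)) by ring]
    ring
  induction n using Nat.strong_induction_on with
  | _ n ih =>
    match n with
    | 0 =>
      have := ncard_stableMultisets φ z hfin 1
      have h1 := hcard 0
      simp [h0] at this
      rw [this] at h1
      rw [zero_add, h1]
      ring
    | 1 =>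
      have := hrec 0
      rw [hcard 1, stableFinsets_zero, h0] at this
      simp only [zero_add, Set.ncard_singleton, Nat.cast_one] at this ⊢
      linear_combination -(q + 1) * this
    | n + 2 =>
      have h1 := hrec (n + 1)
      have h2 := ih n (by omega)
      rw [hcard n, show n + 1 + 2 = n + 2 + 1 by ring, hcard (n + 2)] at h1
      linear_combination -(q + 1) * h1 + h2

end Stable

/-- The monic polynomials of degree `n` with nonzero constant coefficient. -/
def monicPolys (K : Type*) [Field K] (n : ℕ) : Set K[X] :=
  {p | (p.Monic ∧ p.natDegree = n) ∧ p.coeff 0 ≠ 0}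

lemma monicPolys_succ_eq (K : Type*) [Field K] (n : ℕ) : monicPolys K (n + 1) =
    (fun f => (((monicEquivDegreeLT (R := K) (n + 1)).trans
      (degreeLTEquiv K (n + 1)).toEquiv).symm f).1) '' {f : Fin (n + 1) → K | f 0 ≠ 0} := by
  set e := (monicEquivDegreeLT (R := K) (n + 1)).trans (degreeLTEquiv K (n + 1)).toEquiv
  have h0 : ∀ p, e p 0 = p.1.coeff 0 := by
    rintro ⟨p, hp, hn⟩
    change p.eraseLead.coeff ((0 : Fin (n + 1)) : ℕ) = p.coeff 0
    rw [eraseLead_coeff_of_ne]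
    · simp
    · simp [hn]
  ext p
  constructor
  · rintro ⟨hp, hp0⟩
    exact ⟨e ⟨p, hp⟩, by simpa [h0] using hp0, by simp⟩
  · rintro ⟨f, hf, rfl⟩
    refine ⟨(e.symm f).2, ?_⟩
    rw [← h0]
    simpa using hf

lemma finite_monicPolys (K : Type*) [Field K] [Finite K] (n : ℕ) :
    (monicPolys K (n + 1)).Finite := by
  rw [monicPolys_succ_eq]
  exact (Set.toFinite _).image _

lemma ncard_monicPolys (K : Type*) [Field K] [Fintype K] (n : ℕ) :
    (monicPolys K (n + 1)).ncard = (Fintype.card K - 1) * Fintype.card K ^ n := by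
  have h : {f : Fin (n + 1) → K | f 0 ≠ 0} = ↑(Fintype.piFinset
      (Fin.cons (Finset.univ.erase 0) fun _ => Finset.univ : Fin (n + 1) → Finset K)) := by
    ext f
    simp [Fin.forall_fin_succ]
  rw [monicPolys_succ_eq, Set.ncard_image_of_injective _ fun f g hfg =>
    (Equiv.injective _) (Subtype.val_injective hfg), h, Set.ncard_coe_finset,
    Fintype.card_piFinset, Fin.prod_univ_succ]
  simp

section Field

variable (F)

/-- The Frobenius `x ↦ x ^ q` as a permutation of the algebraic closure. -/
def frobPerm : AlgebraicClosure F ≃ AlgebraicClosure F :=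
  (FiniteField.frobeniusAlgEquivOfAlgebraic F (AlgebraicClosure F)).toEquiv

variable {F}

lemma mem_range_em {x : AlgebraicClosure F} (hx : x ^ Fintype.card F = x) : ∃ a, em F a = x := by
  have h : (X ^ Fintype.card F - X : F[X]).Monic := by
    apply monic_X_pow_sub
    rw [degree_X]
    exact_mod_cast Fintype.one_lt_card
  have h2 := h.roots_map_of_card_eq_natDegree (em F) (by
    rw [FiniteField.roots_X_pow_card_sub_X,
      FiniteField.X_pow_card_sub_X_natDegree_eq _ Fintype.one_lt_card]
    rfl)
  have hx' : x ∈ ((X ^ Fintype.card F - X : F[X]).map (em F)).roots := by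
    rw [mem_roots (h.map _).ne_zero]
    simp [hx]
  rw [← h2, Multiset.mem_map] at hx'
  obtain ⟨a, -, ha⟩ := hx'
  exact ⟨a, ha⟩

variable (F)

lemma bijOn_roots (n : ℕ) : Set.BijOn (fun p : F[X] => (p.map (em F)).roots)
    (monicPolys F n) (stableMultisets (frobPerm F) 0 n) := by
  have hprod : ∀ p : F[X], p.Monic →
      ((p.map (em F)).roots.map (X - C ·)).prod = p.map (em F) := fun p hp =>
    ((IsAlgClosed.splits _).eq_prod_roots_of_monic (hp.map _)).symm
  have hfrob : ∀ M : Multiset (AlgebraicClosure F),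
      ((M.map (X - C ·)).prod).map
        ((FiniteField.frobeniusAlgEquivOfAlgebraic F (AlgebraicClosure F) :
          AlgebraicClosure F →+* AlgebraicClosure F)) =
      ((M.map (frobPerm F)).map (X - C ·)).prod := by
    intro M
    rw [Polynomial.map_multiset_prod, Multiset.map_map, Multiset.map_map]
    congr 1
    apply Multiset.map_congr rfl
    intro x _
    simp [frobPerm]
  refine ⟨?_, ?_, ?_⟩
  · rintro p ⟨⟨hp, hn⟩, h0⟩
    refine ⟨?_, ?_, ?_⟩
    · rw [mem_roots (hp.map _).ne_zero, IsRoot, ← coeff_zero_eq_eval_zero, coeff_map]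
      simpa using h0
    · rw [← hn, ← natDegree_map (em F)]
      exact (IsAlgClosed.splits _).natDegree_eq_card_roots.symm
    · have := hfrob (p.map (em F)).roots
      rw [hprod p hp] at this
      have h2 := congrArg roots this
      rw [roots_multiset_prod_X_sub_C] at h2
      rw [← h2]
      congr 1
      ext i
      simp only [coeff_map]
      exact (FiniteField.frobeniusAlgEquivOfAlgebraic F (AlgebraicClosure F)).commutes _
  · rintro p ⟨⟨hp, -⟩, -⟩ p' ⟨⟨hp', -⟩, -⟩ h
    apply map_injective _ (em F).injective
    rw [← hprod p hp, ← hprod p' hp']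
    exact congrArg (fun M => (Multiset.map (X - C ·) M).prod) h
  · rintro M ⟨hM0, hM1, hM2⟩
    set P := (M.map (X - C ·)).prod with hP
    have hPm : P.Monic := monic_multiset_prod_of_monic _ _ fun x _ => monic_X_sub_C x
    have hPl : P ∈ lifts (em F) := by
      rw [lifts_iff_coeff_lifts]
      intro i
      apply mem_range_em
      have := hfrob M
      rw [hM2] at this
      simpa using congrArg (coeff · i) this
    obtain ⟨p, hp, hdeg, hpm⟩ := lifts_and_natDegree_eq_and_monic hPl hPm
    have hroots : (p.map (em F)).roots = M := by rw [hp, hP, roots_multiset_prod_X_sub_C]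
    refine ⟨p, ⟨⟨hpm, ?_⟩, ?_⟩, hroots⟩
    · rw [hdeg, hP, natDegree_multiset_prod_X_sub_C_eq_card, hM1]
    · intro h
      apply hM0
      rw [← hroots, mem_roots (hpm.map _).ne_zero, IsRoot, ← coeff_zero_eq_eval_zero, coeff_map,
        h, map_zero]

lemma finite_stableMultisets_frobPerm (n : ℕ) :
    (stableMultisets (frobPerm F) 0 n).Finite := by
  cases n with
  | zero => simp [stableMultisets_zero]
  | succ n =>
    rw [← (bijOn_roots F (n + 1)).image_eq]
    exact (finite_monicPolys F n).image _

lemma ncard_stableMultisets_frobPerm (n : ℕ) :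
    ((stableMultisets (frobPerm F) 0 (n + 1)).ncard : ℤ) =
      ((Fintype.card F : ℤ) - 1) * (Fintype.card F : ℤ) ^ n := by
  rw [← (bijOn_roots F (n + 1)).image_eq, (bijOn_roots F (n + 1)).injOn.ncard_image,
    ncard_monicPolys]
  push_cast [Fintype.card_pos (α := F)]
  rfl

end Field

/-- The finite set of `m`-th roots of the elements of `T`. -/
def powPreimage {K : Type*} [Field K] (m : ℕ) (T : Finset K) : Finset K :=
  T.biUnion fun t => (nthRoots m t).toFinset

section PowPreimage

variable {K : Type*} [Field K] {m : ℕ}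

lemma mem_powPreimage (hm : 0 < m) {T : Finset K} {x : K} : x ∈ powPreimage m T ↔ x ^ m ∈ T := by
  simp [powPreimage, mem_nthRoots hm]

lemma card_powPreimage [IsAlgClosed K] (hm : 0 < m) {ζ : K} (hζ : IsPrimitiveRoot ζ m)
    {T : Finset K} (hT : 0 ∉ T) : (powPreimage m T).card = T.card * m := by
  rw [powPreimage, Finset.card_biUnion]
  · rw [Finset.sum_const_nat]
    intro t ht
    rw [Multiset.toFinset_card_of_nodup (hζ.nthRoots_nodup (by rintro rfl; exact hT ht)),
      hζ.card_nthRoots, if_pos (IsAlgClosed.exists_pow_nat_eq t hm)]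
  · intro s _ t _ hst
    rw [Function.onFun, Finset.disjoint_left]
    intro x hx hx'
    rw [Multiset.mem_toFinset, mem_nthRoots hm] at hx hx'
    exact hst (hx.symm.trans hx')

lemma pow_mem_of_mul_stable {ζ : K} (hm : 0 < m) (hζ : IsPrimitiveRoot ζ m) {S : Finset K}
    (h0 : (0 : K) ∉ S) (hS : S.image (fun x => ζ * x) = S) {s x : K} (hs : s ∈ S)
    (h : x ^ m = s ^ m) : x ∈ S := by
  have hs0 : s ≠ 0 := by rintro rfl; exact h0 hs
  have : NeZero m := ⟨hm.ne'⟩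
  obtain ⟨i, -, hi⟩ := hζ.eq_pow_of_pow_eq_one (ξ := x / s) (by
    rw [div_pow, h, div_self (pow_ne_zero _ hs0)])
  have key : ∀ j : ℕ, ζ ^ j * s ∈ S := by
    intro j
    induction j with
    | zero => simpa using hs
    | succ j ih =>
      rw [← hS, pow_succ', mul_assoc]
      exact Finset.mem_image_of_mem _ ih
  have := key i
  rwa [hi, div_mul_cancel₀ _ hs0] at this

end PowPreimage

lemma bijOn_powPreimage {m : ℕ} (hm : 0 < m) {lam : F} (hlam : IsPrimitiveRoot (em F lam) m)
    (n : ℕ) : Set.BijOn (powPreimage m) (stableFinsets (frobPerm F) 0 n)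
      {S : Finset (AlgebraicClosure F) |
          (0 : AlgebraicClosure F) ∉ S ∧ S.card = n * m ∧
          S.image (fun x => x ^ Fintype.card F) = S ∧
          S.image (fun x => em F lam * x) = S} := by
  refine ⟨?_, ?_, ?_⟩
  · rintro T ⟨hT0, hT1, hT2⟩
    refine ⟨?_, ?_, ?_, ?_⟩
    · rwa [mem_powPreimage hm, zero_pow hm.ne']
    · rw [card_powPreimage hm hlam hT0, hT1]
    · apply Finset.eq_of_subset_of_card_le
      · intro y hy
        obtain ⟨x, hx, rfl⟩ := Finset.mem_image.1 hy
        rw [mem_powPreimage hm] at hx ⊢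
        rw [← hT2, pow_right_comm]
        exact Finset.mem_map_of_mem _ hx
      · exact (Finset.card_image_of_injective _ (frobPerm F).injective).ge
    · apply Finset.eq_of_subset_of_card_le
      · intro y hy
        obtain ⟨x, hx, rfl⟩ := Finset.mem_image.1 hy
        rw [mem_powPreimage hm] at hx ⊢
        rwa [mul_pow, hlam.pow_eq_one, one_mul]
      · exact (Finset.card_image_of_injective _
          (mul_right_injective₀ (hlam.ne_zero hm.ne'))).ge
  · intro T _ T' _ h
    ext t
    obtain ⟨x, rfl⟩ := IsAlgClosed.exists_pow_nat_eq t hm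
    rw [← mem_powPreimage hm, h, mem_powPreimage hm]
  · rintro S ⟨hS0, hS1, hS2, hS3⟩
    have hpre : powPreimage m (S.image (· ^ m)) = S := by
      ext x
      rw [mem_powPreimage hm, Finset.mem_image]
      constructor
      · rintro ⟨s, hs, h⟩
        exact pow_mem_of_mul_stable hm hlam hS0 hS3 hs h.symm
      · exact fun hx => ⟨x, hx, rfl⟩
    have h0 : (0 : AlgebraicClosure F) ∉ S.image (· ^ m) := by
      rw [Finset.mem_image]
      rintro ⟨s, hs, h⟩
      rw [pow_eq_zero_iff hm.ne'] at h
      exact hS0 (h ▸ hs)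
    refine ⟨S.image (· ^ m), ⟨h0, ?_, ?_⟩, hpre⟩
    · have := card_powPreimage hm hlam h0
      rw [hpre, hS1] at this
      exact (Nat.eq_of_mul_eq_mul_right hm this).symm
    · rw [Finset.map_eq_image, Finset.image_image]
      conv_rhs => rw [← hS2, Finset.image_image]
      apply Finset.image_congr
      intro x _
      exact pow_right_comm x m _

theorem stmt14 {F : Type} [Field F] [Fintype F] (hq : Odd (Fintype.card F))
    (lam : F) (m : ℕ) (hm : orderOf lam = m) (hm1 : 1 < m)
    (n : ℕ) (hn : 1 ≤ n) :
    ((Fintype.card F : ℤ) + 1) *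
      (Set.ncard {S : Finset (AlgebraicClosure F) |
          (0 : AlgebraicClosure F) ∉ S ∧ S.card = n * m ∧
          S.image (fun x => x ^ Fintype.card F) = S ∧
          S.image (fun x => em F lam * x) = S} : ℤ)
    = ((Fintype.card F : ℤ) - 1) * ((Fintype.card F : ℤ) ^ n - (-1) ^ n) := by
  have hm0 : 0 < m := by omega
  have hlam : IsPrimitiveRoot (em F lam) m :=
    (hm ▸ IsPrimitiveRoot.orderOf lam).map_of_injective (em F).injective
  obtain ⟨n, rfl⟩ := Nat.exists_eq_add_of_le' hn
  have hbij := bijOn_powPreimage hm0 hlam (n + 1)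
  rw [← hbij.image_eq, hbij.injOn.ncard_image]
  exact ncard_stableFinsets (frobPerm F) 0 _ (finite_stableMultisets_frobPerm F)
    (ncard_stableMultisets_frobPerm F) n

end Hyp
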